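/- (Main theorem.) Let Π : ℝⁿ → Mₙ(ℝ) be smooth with antisymmetric values, let H, C̃ : ℝⁿ → ℝ be smooth with Π(x)·∇C̃(x) = 0 for all x, and let G(x) = ∇H(x)(∇H(x))ᵀ − ‖∇H(x)‖² Iₙ. Let x_e ∈ ℝⁿ satisfy Π(x_e)·∇H(x_e) = 0, and set H_φ = H + C̃. Assume (i) ∇H_φ(x_e) = 0 and (ii) the Hessian of H_φ at x_e is positive definite. Let φ : ℝ × ℝⁿ → ℝⁿ be a global flow whose orbits solve the metriplectic system ẋ = Π(x)·∇H(x) + G(x)·∇C̃(x). Then x_e is an equilibrium of this system, and there exist a compact neighborhood U of x_e and a neighborhood V ⊆ U of x_e such that for every x ∈ V: φ(t,x) ∈ U for all t ≥ 0 and the ω-limit set ω(x) is contained in U ∩ E, where E = {y ∈ ℝⁿ : ∇H(y) and ∇C̃(y) are linearly dependent}. -/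

import Mathlib

open Matrix Filter

/-- The gradient of a function on `ℝⁿ` (as `Fin n → ℝ`), given by its partial derivatives. -/
noncomputable def grad {n : ℕ} (f : (Fin n → ℝ) → ℝ) (x : Fin n → ℝ) : Fin n → ℝ :=
  fun i => fderiv ℝ f x (Pi.single i 1)

/-- The dissipation matrix `G(x) = ∇H(x)(∇H(x))ᵀ − ‖∇H(x)‖² Iₙ`. -/
noncomputable def Gmat {n : ℕ} (H : (Fin n → ℝ) → ℝ) (x : Fin n → ℝ) :
    Matrix (Fin n) (Fin n) ℝ :=
  Matrix.vecMulVec (grad H x) (grad H x) -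
    (∑ i, (grad H x i) ^ 2) • (1 : Matrix (Fin n) (Fin n) ℝ)

/-- The Hessian matrix of second partial derivatives of `f` at `x`. -/
noncomputable def hess {n : ℕ} (f : (Fin n → ℝ) → ℝ) (x : Fin n → ℝ) :
    Matrix (Fin n) (Fin n) ℝ :=
  Matrix.of fun i j => fderiv ℝ (fun y => fderiv ℝ f y (Pi.single j 1)) x (Pi.single i 1)

/-- The ω-limit set of a point `x` under a flow `φ`. -/
def omegaSet {n : ℕ} (φ : ℝ → (Fin n → ℝ) → (Fin n → ℝ)) (x : Fin n → ℝ) :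
    Set (Fin n → ℝ) :=
  {y | ∃ t : ℕ → ℝ, Tendsto t atTop atTop ∧
        Tendsto (fun k => φ (t k) x) atTop (nhds y)}

/-- A positive definite bilinear form on a finite-dimensional space is bounded below by a positive
multiple of the squared norm. -/
lemma exists_pos_mul_norm_sq_le {E : Type*} [NormedAddCommGroup E] [NormedSpace ℝ E]
    [FiniteDimensional ℝ E] (A : E →L[ℝ] E →L[ℝ] ℝ) (hA : ∀ h, h ≠ 0 → 0 < A h h) :
    ∃ c > 0, ∀ h, c * ‖h‖ ^ 2 ≤ A h h := by
  have hcont : Continuous fun h => A h h := A.continuous.clm_apply continuous_id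
  obtain hS | hS := (Metric.sphere (0 : E) 1).eq_empty_or_nonempty
  · refine ⟨1, one_pos, fun h => ?_⟩
    have h0 : h = 0 := by
      by_contra hne
      have : ‖h‖⁻¹ • h ∈ Metric.sphere (0 : E) 1 := by
        simp [norm_smul, hne]
      simp [hS] at this
    simp [h0]
  · obtain ⟨v, hv, hmin⟩ := (isCompact_sphere (0 : E) 1).exists_isMinOn hS hcont.continuousOn
    have hv1 : ‖v‖ = 1 := by simpa using hv
    refine ⟨A v v, hA v (by rintro rfl; simp at hv1), fun h => ?_⟩
    by_cases hne : h = 0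
    · simp [hne]
    have hpos : 0 < ‖h‖ := norm_pos_iff.mpr hne
    have hmem : ‖h‖⁻¹ • h ∈ Metric.sphere (0 : E) 1 := by
      simp [norm_smul, hne]
    have hle : A v v ≤ A (‖h‖⁻¹ • h) (‖h‖⁻¹ • h) := hmin hmem
    have heq : A h h = A (‖h‖⁻¹ • h) (‖h‖⁻¹ • h) * ‖h‖ ^ 2 := by
      simp only [map_smul, _root_.smul_apply, smul_eq_mul]
      field_simp
    rw [heq]
    gcongr

/-- The second derivative test: a critical point with positive definite second derivative is a
strict local minimum. -/
lemma eventually_lt_of_fderiv_fderiv_pos {E : Type*} [NormedAddCommGroup E] [NormedSpace ℝ E]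
    [FiniteDimensional ℝ E] {f : E → ℝ} {a : E} (hf : Differentiable ℝ f)
    (hf' : DifferentiableAt ℝ (fderiv ℝ f) a) (hcrit : fderiv ℝ f a = 0)
    (hpos : ∀ h, h ≠ 0 → 0 < fderiv ℝ (fderiv ℝ f) a h h) :
    ∀ᶠ x in nhds a, x ≠ a → f a < f x := by
  obtain ⟨c, hc, hcA⟩ := exists_pos_mul_norm_sq_le _ hpos
  have hlittle := hf'.hasFDerivAt.isLittleO.def (half_pos hc)
  obtain ⟨ε, hε, hball⟩ := Metric.eventually_nhds_iff_ball.mp hlittle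
  refine Metric.eventually_nhds_iff_ball.mpr ⟨ε, hε, fun x hx hxa => ?_⟩
  set h := x - a with hh
  have hhne : h ≠ 0 := sub_ne_zero.mpr hxa
  have hhpos : 0 < ‖h‖ := norm_pos_iff.mpr hhne
  have hhε : ‖h‖ < ε := by simpa [hh, dist_eq_norm] using hx
  have hderiv : ∀ t : ℝ, HasDerivAt (fun t : ℝ => f (a + t • h)) (fderiv ℝ f (a + t • h) h) t := by
    intro t
    have h1 : HasDerivAt (fun t : ℝ => a + t • h) h t := by
      simpa using ((hasDerivAt_id t).smul_const h).const_add a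
    exact (hf _).hasFDerivAt.comp_hasDerivAt t h1
  have hderiv_pos : ∀ t ∈ Set.Ioo (0 : ℝ) 1, 0 < fderiv ℝ f (a + t • h) h := by
    rintro t ⟨ht0, ht1⟩
    have hnorm : ‖t • h‖ = t * ‖h‖ := by rw [norm_smul, Real.norm_of_nonneg ht0.le]
    have hmem : a + t • h ∈ Metric.ball a ε := by
      rw [mem_ball_iff_norm, add_sub_cancel_left, hnorm]
      nlinarith
    have hb := hball _ hmem
    rw [hcrit, sub_zero, add_sub_cancel_left, hnorm] at hb
    have hop := (ContinuousLinearMap.le_opNorm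
      (fderiv ℝ f (a + t • h) - fderiv ℝ (fderiv ℝ f) a (t • h)) h).trans
      (mul_le_mul_of_nonneg_right hb hhpos.le)
    rw [Real.norm_eq_abs] at hop
    have hlow := (abs_le.mp hop).1
    simp only [_root_.sub_apply, map_smul, _root_.smul_apply,
      smul_eq_mul] at hlow
    have hA := mul_le_mul_of_nonneg_left (hcA h) ht0.le
    have hsq : 0 < c / 2 * (t * ‖h‖) * ‖h‖ := by positivity
    nlinarith
  have hmono : StrictMonoOn (fun t : ℝ => f (a + t • h)) (Set.Icc 0 1) := by
    refine strictMonoOn_of_deriv_pos (convex_Icc 0 1)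
      (fun t _ => (hderiv t).continuousAt.continuousWithinAt) fun t ht => ?_
    rw [interior_Icc] at ht
    rw [(hderiv t).deriv]
    exact hderiv_pos t ht
  have := hmono (Set.left_mem_Icc.mpr zero_le_one) (Set.right_mem_Icc.mpr zero_le_one) one_pos
  simpa [hh] using this

/-- A curve starting in a ball, along which a function stays below its values on the bounding
sphere, never leaves the ball. -/
lemma mem_closedBall_of_forall_lt_of_le_sphere {E : Type*} [PseudoMetricSpace E] {L : E → ℝ}
    {γ : ℝ → E} {a : E} {r m : ℝ} (hγ : Continuous γ) (h0 : γ 0 ∈ Metric.closedBall a r)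
    (hsphere : ∀ x ∈ Metric.sphere a r, m ≤ L x) (hL : ∀ t, 0 ≤ t → L (γ t) < m)
    {t : ℝ} (ht : 0 ≤ t) : γ t ∈ Metric.closedBall a r := by
  by_contra hout
  rw [Metric.mem_closedBall] at h0 hout
  obtain ⟨s, hs, hsr⟩ := intermediate_value_Icc ht
    (hγ.dist continuous_const : Continuous fun s => dist (γ s) a).continuousOn
    ⟨h0, (not_le.mp hout).le⟩
  exact (hL s hs.1).not_ge (hsphere _ hsr)

/-- The core of LaSalle's invariance principle: at an ω-limit point of a precompact integral curve
of a continuous vector field, the dissipation rate of a Lyapunov function vanishes. -/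
lemma dissipation_eq_zero_of_tendsto {E : Type*} [NormedAddCommGroup E] [NormedSpace ℝ E]
    {L D : E → ℝ} {X : E → E} {γ : ℝ → E} {K : Set E} {y : E} {u : ℕ → ℝ}
    (hL : Continuous L) (hD : Continuous D) (hX : Continuous X) (hD0 : ∀ x, 0 ≤ D x)
    (hγ : ∀ t, HasDerivAt γ (X (γ t)) t)
    (hLγ : ∀ t, HasDerivAt (fun s => L (γ s)) (-D (γ t)) t)
    (hK : IsCompact K) (hγK : ∀ t, 0 ≤ t → γ t ∈ K)
    (hu : Tendsto u atTop atTop) (hy : Tendsto (fun k => γ (u k)) atTop (nhds y)) :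
    D y = 0 := by
  by_contra hne
  have hDy : D y / 2 < D y := half_lt_self ((hD0 y).lt_of_ne' hne)
  have hδ : 0 < D y / 2 := half_pos ((hD0 y).lt_of_ne' hne)
  obtain ⟨ε, hε, hball⟩ := Metric.eventually_nhds_iff_ball.mp
    (hD.continuousAt.eventually (lt_mem_nhds hDy))
  obtain ⟨M, hM, hXM⟩ : ∃ M > 0, ∀ x ∈ K, ‖X x‖ ≤ M := by
    obtain ⟨M, hM⟩ := hK.exists_bound_of_continuousOn hX.continuousOn
    exact ⟨max M 1, by positivity, fun x hx => (hM x hx).trans (le_max_left _ _)⟩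
  have hlip : ∀ s t, 0 ≤ s → s ≤ t → ‖γ t - γ s‖ ≤ M * (t - s) := by
    intro s t hs hst
    have := (convex_Ici (0 : ℝ)).norm_image_sub_le_of_norm_hasDerivWithin_le
      (fun t _ => (hγ t).hasDerivWithinAt) (fun t ht => hXM _ (hγK t ht)) hs (hs.trans hst)
    rwa [Real.norm_of_nonneg (sub_nonneg.mpr hst)] at this
  have hanti : Antitone fun t => L (γ t) :=
    antitone_of_deriv_nonpos (fun t => (hLγ t).differentiableAt)
      fun t => by rw [(hLγ t).deriv]; exact neg_nonpos.mpr (hD0 _)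
  have hLy : Tendsto (fun k => L (γ (u k))) atTop (nhds (L y)) := (hL.tendsto y).comp hy
  have hlow : ∀ t, L y ≤ L (γ t) := fun t =>
    le_of_tendsto hLy ((hu.eventually_ge_atTop t).mono fun k hk => hanti hk)
  set τ := ε / (2 * M) with hτ
  have hτ0 : 0 < τ := by positivity
  have hMτ : M * τ = ε / 2 := by rw [hτ]; field_simp
  have hdrop : ∀ᶠ k in atTop, L y + D y / 2 * τ ≤ L (γ (u k)) := by
    filter_upwards [hu.eventually_ge_atTop 0, hy.eventually (Metric.ball_mem_nhds y (half_pos hε))]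
      with k hk0 hk
    have hmv := (convex_Icc (u k) (u k + τ)).image_sub_le_mul_sub_of_deriv_le (C := -(D y / 2))
      (f := fun t => L (γ t)) (fun t _ => (hLγ t).continuousAt.continuousWithinAt)
      (fun t _ => (hLγ t).differentiableAt.differentiableWithinAt) (fun t ht => by
        rw [interior_Icc] at ht
        rw [(hLγ t).deriv]
        refine neg_le_neg (hball _ ?_).le
        have h1 := hlip (u k) t hk0 ht.1.le
        have h2 : M * (t - u k) ≤ M * τ := by
          have := ht.2
          gcongr
          linarith
        rw [Metric.mem_ball]
        rw [← dist_eq_norm] at h1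
        linarith [dist_triangle (γ t) (γ (u k)) y])
      (u k) (Set.left_mem_Icc.mpr (by linarith)) (u k + τ) (Set.right_mem_Icc.mpr (by linarith))
      (by linarith)
    have := hlow (u k + τ)
    simp only [add_sub_cancel_left] at hmv
    linarith
  have := ge_of_tendsto hLy hdrop
  nlinarith [mul_pos hδ hτ0]

/-- The Gram determinant of two linearly independent real vectors is positive. -/
lemma gram_pos_of_linearIndependent {ι : Type*} [Fintype ι] {u v : ι → ℝ}
    (h : LinearIndependent ℝ ![u, v]) : 0 < (u ⬝ᵥ u) * (v ⬝ᵥ v) - (u ⬝ᵥ v) ^ 2 := by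
  have hu : 0 < u ⬝ᵥ u := by
    rw [← star_trivial u]
    simpa using dotProduct_star_self_pos_iff.mpr (h.ne_zero 0)
  have hw : (u ⬝ᵥ u) • v - (u ⬝ᵥ v) • u ≠ 0 := fun h0 => by
    have := LinearIndependent.pair_iff.mp h (-(u ⬝ᵥ v)) (u ⬝ᵥ u)
      (by rw [← h0, neg_smul]; abel)
    exact hu.ne' this.2
  have hw' : 0 < ((u ⬝ᵥ u) • v - (u ⬝ᵥ v) • u) ⬝ᵥ ((u ⬝ᵥ u) • v - (u ⬝ᵥ v) • u) := by
    simpa using dotProduct_star_self_pos_iff.mpr hw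
  have heq : ((u ⬝ᵥ u) • v - (u ⬝ᵥ v) • u) ⬝ᵥ ((u ⬝ᵥ u) • v - (u ⬝ᵥ v) • u) =
      (u ⬝ᵥ u) * ((u ⬝ᵥ u) * (v ⬝ᵥ v) - (u ⬝ᵥ v) ^ 2) := by
    simp only [sub_dotProduct, dotProduct_sub, smul_dotProduct, dotProduct_smul, smul_eq_mul,
      dotProduct_comm v u]
    ring
  rw [heq] at hw'
  exact pos_of_mul_pos_right hw' hu.le

lemma gram_nonneg {ι : Type*} [Fintype ι] (u v : ι → ℝ) :
    0 ≤ (u ⬝ᵥ u) * (v ⬝ᵥ v) - (u ⬝ᵥ v) ^ 2 := by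
  have := Finset.sum_mul_sq_le_sq_mul_sq Finset.univ u v
  simp only [dotProduct, ← pow_two]
  linarith

lemma fderiv_apply_eq_grad_dotProduct {n : ℕ} (f : (Fin n → ℝ) → ℝ) (x v : Fin n → ℝ) :
    fderiv ℝ f x v = grad f x ⬝ᵥ v := by
  conv_lhs => rw [pi_eq_sum_univ' v]
  simp [grad, dotProduct, mul_comm]

lemma contDiff_grad_apply {n : ℕ} {f : (Fin n → ℝ) → ℝ} (hf : ContDiff ℝ (⊤ : ℕ∞) f) (i : Fin n) :
    ContDiff ℝ (⊤ : ℕ∞) fun x => grad f x i :=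
  (hf.fderiv_right (m := (⊤ : ℕ∞)) (by simp)).clm_apply contDiff_const

lemma continuous_grad {n : ℕ} {f : (Fin n → ℝ) → ℝ} (hf : ContDiff ℝ (⊤ : ℕ∞) f) :
    Continuous (grad f) :=
  continuous_pi fun i => (contDiff_grad_apply hf i).continuous

lemma grad_add {n : ℕ} {f g : (Fin n → ℝ) → ℝ} {x : Fin n → ℝ} (hf : DifferentiableAt ℝ f x)
    (hg : DifferentiableAt ℝ g x) : grad (fun y => f y + g y) x = grad f x + grad g x := by
  ext i
  simp [grad, fderiv_fun_add hf hg]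

lemma fderiv_fderiv_apply_eq_dotProduct_hess {n : ℕ} {f : (Fin n → ℝ) → ℝ} {x : Fin n → ℝ}
    (hf : DifferentiableAt ℝ (fderiv ℝ f) x) (v w : Fin n → ℝ) :
    fderiv ℝ (fderiv ℝ f) x v w = v ⬝ᵥ (hess f x *ᵥ w) := by
  have hij : ∀ i j, hess f x i j =
      fderiv ℝ (fderiv ℝ f) x (Pi.single i 1) (Pi.single j 1) := fun i j => by
    simp [hess, fderiv_clm_apply hf (differentiableAt_const _)]
  conv_lhs => rw [pi_eq_sum_univ' v, pi_eq_sum_univ' w]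
  simp only [map_sum, map_smul, _root_.sum_apply, _root_.smul_apply, smul_eq_mul, dotProduct,
    mulVec, hij, Finset.mul_sum]
  rw [Finset.sum_comm]
  exact Finset.sum_congr rfl fun i _ => Finset.sum_congr rfl fun j _ => by ring

lemma Gmat_mulVec {n : ℕ} (H : (Fin n → ℝ) → ℝ) (x v : Fin n → ℝ) :
    Gmat H x *ᵥ v = (grad H x ⬝ᵥ v) • grad H x - (grad H x ⬝ᵥ grad H x) • v := by
  rw [Gmat, sub_mulVec, vecMulVec_mulVec, op_smul_eq_smul, smul_mulVec, one_mulVec]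
  simp only [dotProduct, pow_two]

lemma dotProduct_mulVec_eq_neg_of_transpose_eq_neg {ι : Type*} [Fintype ι] {A : Matrix ι ι ℝ}
    (hA : Aᵀ = -A) (u v : ι → ℝ) : u ⬝ᵥ (A *ᵥ v) = -(v ⬝ᵥ (A *ᵥ u)) := by
  rw [dotProduct_mulVec, ← mulVec_transpose, hA, neg_mulVec, neg_dotProduct, dotProduct_comm]

/-- Along a metriplectic vector field, the derivative of `H + C̃` is minus the Gram determinant of
the gradients of `H` and `C̃`. -/
lemma add_dotProduct_metriplectic {n : ℕ} {A : Matrix (Fin n) (Fin n) ℝ} (hA : Aᵀ = -A)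
    (H : (Fin n → ℝ) → ℝ) (x v : Fin n → ℝ) (hv : A *ᵥ v = 0) :
    (grad H x + v) ⬝ᵥ (A *ᵥ grad H x + Gmat H x *ᵥ v) =
      -((grad H x ⬝ᵥ grad H x) * (v ⬝ᵥ v) - (grad H x ⬝ᵥ v) ^ 2) := by
  have h1 : grad H x ⬝ᵥ (A *ᵥ grad H x) = 0 := by
    linarith [dotProduct_mulVec_eq_neg_of_transpose_eq_neg hA (grad H x) (grad H x)]
  have h2 : v ⬝ᵥ (A *ᵥ grad H x) = 0 := by
    rw [dotProduct_mulVec_eq_neg_of_transpose_eq_neg hA, hv, dotProduct_zero, neg_zero]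
  simp only [Gmat_mulVec, add_dotProduct, dotProduct_add, dotProduct_sub, dotProduct_smul, h1, h2,
    smul_eq_mul, dotProduct_comm v (grad H x)]
  ring

/-- Theorem 3.2, the main theorem: if `x_e` is an equilibrium of the
Hamilton–Poisson system with `∇H_φ(x_e) = 0` and `δ²H_φ(x_e)` positive definite
(`H_φ = H + C̃`), then `x_e` is an equilibrium of the metriplectic system
`ẋ = Π·∇H + G·∇C̃` and there are a compact neighborhood `U` of `x_e` and a
neighborhood `V ⊆ U` such that every solution starting in `V` stays in `U` for
`t ≥ 0` and its ω-limit set lies in `U ∩ E`, where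
`E = {y : ∇H(y), ∇C̃(y) are linearly dependent}`. -/
theorem main_theorem {n : ℕ}
    (P : (Fin n → ℝ) → Matrix (Fin n) (Fin n) ℝ)
    (hP : ∀ i j, ContDiff ℝ (⊤ : ℕ∞) (fun x => P x i j))
    (hPanti : ∀ x, (P x)ᵀ = - P x)
    (H Ct : (Fin n → ℝ) → ℝ)
    (hH : ContDiff ℝ (⊤ : ℕ∞) H) (hCt : ContDiff ℝ (⊤ : ℕ∞) Ct)
    (hCas : ∀ x, (P x).mulVec (grad Ct x) = 0)
    (x_e : Fin n → ℝ)
    (hx_e : (P x_e).mulVec (grad H x_e) = 0)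
    (hcrit : grad (fun y => H y + Ct y) x_e = 0)
    (hposdef : (hess (fun y => H y + Ct y) x_e).PosDef)
    (φ : ℝ → (Fin n → ℝ) → (Fin n → ℝ))
    (hφ0 : ∀ x, φ 0 x = x)
    (hφadd : ∀ t s x, φ (t + s) x = φ t (φ s x))
    (hφderiv : ∀ t x, HasDerivAt (fun s => φ s x)
      ((P (φ t x)).mulVec (grad H (φ t x)) + (Gmat H (φ t x)).mulVec (grad Ct (φ t x))) t) :
    ((P x_e).mulVec (grad H x_e) + (Gmat H x_e).mulVec (grad Ct x_e) = 0) ∧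
      ∃ U : Set (Fin n → ℝ), IsCompact U ∧ U ∈ nhds x_e ∧
        ∃ V ∈ nhds x_e, V ⊆ U ∧ ∀ x ∈ V,
          (∀ t : ℝ, 0 ≤ t → φ t x ∈ U) ∧
          omegaSet φ x ⊆ U ∩ {y | ¬ LinearIndependent ℝ ![grad H y, grad Ct y]} := by
  set L : (Fin n → ℝ) → ℝ := fun y => H y + Ct y with hLdef
  have hL : ContDiff ℝ (⊤ : ℕ∞) L := hH.add hCt
  have hHd : Differentiable ℝ H := hH.differentiable (by simp)
  have hCd : Differentiable ℝ Ct := hCt.differentiable (by simp)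
  have hLd : Differentiable ℝ L := hL.differentiable (by simp)
  have hgrad : ∀ x, grad L x = grad H x + grad Ct x := fun x => grad_add (hHd x) (hCd x)
  refine ⟨?_, ?_⟩
  · have hCe : grad Ct x_e = -grad H x_e :=
      (neg_eq_of_add_eq_zero_right ((hgrad x_e).symm.trans hcrit)).symm
    rw [hx_e, Gmat_mulVec, hCe]
    simp
  set D : (Fin n → ℝ) → ℝ := fun x =>
    (grad H x ⬝ᵥ grad H x) * (grad Ct x ⬝ᵥ grad Ct x) - (grad H x ⬝ᵥ grad Ct x) ^ 2 with hDdef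
  set X : (Fin n → ℝ) → Fin n → ℝ := fun x =>
    P x *ᵥ grad H x + Gmat H x *ᵥ grad Ct x with hXdef
  have hcH := continuous_grad hH
  have hcC := continuous_grad hCt
  have hD : Continuous D :=
    ((hcH.dotProduct hcH).mul (hcC.dotProduct hcC)).sub ((hcH.dotProduct hcC).pow 2)
  have hX : Continuous X := by
    have hPc : Continuous P := continuous_matrix fun i j => (hP i j).continuous
    simp only [hXdef, Gmat_mulVec]
    exact (hPc.matrix_mulVec hcH).add
      (((hcH.dotProduct hcC).smul hcH).sub ((hcH.dotProduct hcH).smul hcC))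
  have hφc : ∀ x, Continuous fun t => φ t x := fun x =>
    continuous_iff_continuousAt.mpr fun t => (hφderiv t x).continuousAt
  have hLφ : ∀ x t, HasDerivAt (fun s => L (φ s x)) (-D (φ t x)) t := fun x t => by
    have h := (hLd (φ t x)).hasFDerivAt.comp_hasDerivAt t (hφderiv t x)
    rwa [fderiv_apply_eq_grad_dotProduct, hgrad,
      add_dotProduct_metriplectic (hPanti _) _ _ _ (hCas _)] at h
  have hanti : ∀ x, Antitone fun t => L (φ t x) := fun x =>
    antitone_of_deriv_nonpos (fun t => (hLφ x t).differentiableAt)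
      fun t => by rw [(hLφ x t).deriv]; exact neg_nonpos.mpr (gram_nonneg _ _)
  have hL'd : DifferentiableAt ℝ (fderiv ℝ L) x_e :=
    (hL.fderiv_right (m := (⊤ : ℕ∞)) (by simp)).differentiable (by simp) x_e
  have hmin : ∀ᶠ x in nhds x_e, x ≠ x_e → L x_e < L x := by
    refine eventually_lt_of_fderiv_fderiv_pos hLd hL'd ?_ fun h hh => ?_
    · ext1 v
      rw [fderiv_apply_eq_grad_dotProduct, hcrit, zero_dotProduct, _root_.zero_apply]
    · rw [fderiv_fderiv_apply_eq_dotProduct_hess hL'd]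
      simpa using hposdef.dotProduct_mulVec_pos hh
  obtain ⟨r, hr, hball⟩ := Metric.nhds_basis_closedBall.eventually_iff.mp hmin
  obtain ⟨m, hm, hsphere⟩ : ∃ m, L x_e < m ∧ ∀ x ∈ Metric.sphere x_e r, m ≤ L x := by
    obtain hS | hS := (Metric.sphere x_e r).eq_empty_or_nonempty
    · exact ⟨L x_e + 1, lt_add_one _, by simp [hS]⟩
    · obtain ⟨z, hz, hzmin⟩ :=
        (isCompact_sphere x_e r).exists_isMinOn hS hL.continuous.continuousOn
      exact ⟨L z, hball (Metric.sphere_subset_closedBall hz) (Metric.ne_of_mem_sphere hz hr.ne'),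
        fun x hx => hzmin hx⟩
  refine ⟨Metric.closedBall x_e r, isCompact_closedBall x_e r, Metric.closedBall_mem_nhds x_e hr,
    Metric.closedBall x_e r ∩ {x | L x < m},
    inter_mem (Metric.closedBall_mem_nhds x_e hr)
      (hL.continuous.continuousAt.eventually (gt_mem_nhds hm)),
    Set.inter_subset_left, ?_⟩
  rintro x ⟨hxr, hxm⟩
  have hstay : ∀ t : ℝ, 0 ≤ t → φ t x ∈ Metric.closedBall x_e r := fun t ht =>
    mem_closedBall_of_forall_lt_of_le_sphere (hφc x) (by rwa [hφ0]) hsphere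
      (fun s hs => (hanti x hs).trans_lt (by simpa only [hφ0, Set.mem_ofPred_eq] using hxm)) ht
  refine ⟨hstay, ?_⟩
  rintro y ⟨u, hu, hy⟩
  refine ⟨Metric.isClosed_closedBall.mem_of_tendsto hy
    ((hu.eventually_ge_atTop 0).mono fun k hk => hstay _ hk), fun hind => ?_⟩
  have hDy : D y = 0 := dissipation_eq_zero_of_tendsto hL.continuous hD hX
    (fun x => gram_nonneg _ _) (fun t => hφderiv t x) (hLφ x) (isCompact_closedBall x_e r)
    hstay hu hy
  exact (gram_pos_of_linearIndependent hind).ne' hDy
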